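/- For every integer Q≥2 there exist constants C_Q,c_Q>0 such that the following holds. Let (K^Π) be a reversible Q-trace family on a finite set R with positive probability measure π_R, let θ>0, and suppose β_R(S,ℓ) ≥ θ for every nonempty S⊆R and every ℓ:S→[Q]. Then for every integer k ≥ C_Q·θ^{−2}·log(8|R|), the set of starts s∈R with the property that for every a∈[Q] there exists a time 0≤t_a≤k with Amb_{t_a}(s,a) ≥ c_Q·θ has π_R-mass at least 3/4. -/

import Mathlib

open scoped Classical

noncomputable section

/-- Label lift of a `Q`-trace family: `K̂((u,b),(v,c)) = Σ_{Π : Π(b)=c} K^Π(u,v)`,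
as a matrix on `R × [Q]`. -/
def liftK {Q : ℕ} {R : Type} [Fintype R] [DecidableEq R]
    (K : Equiv.Perm (Fin Q) → R → R → ℝ) : Matrix (R × Fin Q) (R × Fin Q) ℝ :=
  Matrix.of fun p q => ∑ g : Equiv.Perm (Fin Q), if g p.2 = q.2 then K g p.1 q.1 else 0

/-- Ambiguity after `t` steps of the label lift started from `(s,a)`. -/
def AmbT {Q : ℕ} {R : Type} [Fintype R] [DecidableEq R]
    (K : Equiv.Perm (Fin Q) → R → R → ℝ) (s : R) (a : Fin Q) (t : ℕ) : ℝ :=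
  ∑ v : R, ((∑ b : Fin Q, (liftK K ^ t) (s, a) (v, b)) -
    ⨆ b : Fin Q, (liftK K ^ t) (s, a) (v, b))

/-- Failure probability of a partial labeling `ℓ` on `S` under one trace step. -/
def betaTr {Q : ℕ} {R : Type} [Fintype R] [DecidableEq R]
    (piR : R → ℝ) (K : Equiv.Perm (Fin Q) → R → R → ℝ) (S : Finset R) (ℓ : R → Fin Q) : ℝ :=
  (∑ u ∈ S, piR u)⁻¹ *
    ∑ u ∈ S, piR u *
      ((∑ v ∈ Sᶜ, ∑ g : Equiv.Perm (Fin Q), K g u v) +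
        ∑ v ∈ S, ∑ g : Equiv.Perm (Fin Q), if ℓ v ≠ g (ℓ u) then K g u v else 0)

/-- Bregman divergence of `x log x` dominates the squared Hellinger distance. -/
lemma sq_sqrt_sub_sqrt_le_bregman {x m : ℝ} (hx : 0 ≤ x) (hm : 0 < m) :
    (√x - √m) ^ 2 ≤ x * Real.log x - m * Real.log m - (Real.log m + 1) * (x - m) := by
  have h1 : (√x - √m) ^ 2 = x + m - 2 * (√x * √m) := by
    nlinarith [Real.sq_sqrt hx, Real.sq_sqrt hm.le]
  rcases hx.eq_or_lt with rfl | hx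
  · simp only [Real.sqrt_zero, zero_mul, zero_sub] at *
    nlinarith
  have hsx := Real.sqrt_pos.2 hx
  have hsm := Real.sqrt_pos.2 hm
  have h2 := Real.log_le_sub_one_of_pos (div_pos hsm hsx)
  rw [Real.log_div hsm.ne' hsx.ne', Real.log_sqrt hx.le, Real.log_sqrt hm.le] at h2
  have h3 : x * (√m / √x) = √x * √m := by
    field_simp
    rw [Real.sq_sqrt hx.le]
  nlinarith [mul_le_mul_of_nonneg_left h2 hx.le]

/-- Relative entropy `∑ w ψ log ψ` of the density `ψ` with respect to the weight `w`. -/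
def relEntropy {X : Type} [Fintype X] (w ψ : X → ℝ) : ℝ :=
  ∑ x, w x * (ψ x * Real.log (ψ x))

section ReversibleKernel

variable {X : Type} [Fintype X] {w ψ : X → ℝ} {M : Matrix X X ℝ}

lemma sum_mul_sq_sqrt_sub_le (hM : ∀ x y, 0 ≤ M x y) (hrow : ∀ x, ∑ y, M x y = 1)
    (hψ : ∀ x, 0 ≤ ψ x) (y : X) :
    ∑ x, M y x * (√(ψ x) - √((M.mulVec ψ) y)) ^ 2 ≤
      ∑ x, M y x * (ψ x * Real.log (ψ x)) -
        (M.mulVec ψ) y * Real.log ((M.mulVec ψ) y) := by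
  have hmdef : (M.mulVec ψ) y = ∑ x, M y x * ψ x := rfl
  set m := (M.mulVec ψ) y with hm
  have hm0 : 0 ≤ m := by
    rw [hmdef]; exact Finset.sum_nonneg fun x _ => mul_nonneg (hM _ _) (hψ _)
  rcases hm0.eq_or_lt with h0 | hpos
  · rw [← h0]
    have hz : ∀ x, M y x * ψ x = 0 := fun x =>
      (Finset.sum_eq_zero_iff_of_nonneg fun x _ => mul_nonneg (hM y x) (hψ x)).1
        (hmdef.symm.trans h0.symm) x (Finset.mem_univ x)
    refine le_of_eq ?_
    simp only [Real.sqrt_zero, sub_zero, zero_mul]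
    refine Finset.sum_congr rfl fun x _ => ?_
    rw [Real.sq_sqrt (hψ x), ← mul_assoc, hz x, zero_mul]
  · calc ∑ x, M y x * (√(ψ x) - √m) ^ 2
        ≤ ∑ x, M y x * (ψ x * Real.log (ψ x) - m * Real.log m
            - (Real.log m + 1) * (ψ x - m)) :=
          Finset.sum_le_sum fun x _ =>
            mul_le_mul_of_nonneg_left (sq_sqrt_sub_sqrt_le_bregman (hψ x) hpos) (hM _ _)
      _ = ∑ x, (M y x * (ψ x * Real.log (ψ x)) - M y x * (m * Real.log m)
            - ((Real.log m + 1) * (M y x * ψ x) - M y x * ((Real.log m + 1) * m))) :=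
          Finset.sum_congr rfl fun x _ => by ring
      _ = _ := by
          rw [Finset.sum_sub_distrib, Finset.sum_sub_distrib, Finset.sum_sub_distrib,
            ← Finset.sum_mul, ← Finset.sum_mul, ← Finset.mul_sum, ← hmdef, hrow]
          ring

lemma sum_weight_mul_mulVec (hrow : ∀ x, ∑ y, M x y = 1)
    (hrev : ∀ x y, w x * M x y = w y * M y x) (f : X → ℝ) :
    ∑ y, w y * ∑ x, M y x * f x = ∑ x, w x * f x := by
  simp_rw [Finset.mul_sum]
  rw [Finset.sum_comm]
  refine Finset.sum_congr rfl fun x _ => ?_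
  calc ∑ y, w y * (M y x * f x) = ∑ y, M x y * (w x * f x) :=
        Finset.sum_congr rfl fun y _ => by rw [← mul_assoc, hrev y x]; ring
    _ = _ := by rw [← Finset.sum_mul, hrow, one_mul]

/-- A reversible step whose entropy loss is small moves the density little in `L¹`. -/
lemma sq_sum_abs_sub_mulVec_le (hw : ∀ x, 0 < w x) (hM : ∀ x y, 0 ≤ M x y)
    (hrow : ∀ x, ∑ y, M x y = 1) (hrev : ∀ x y, w x * M x y = w y * M y x)
    (hψ : ∀ x, 0 ≤ ψ x) (hψ1 : ∑ x, w x * ψ x = 1) :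
    (∑ y, ∑ x, w y * M y x * |ψ x - (M.mulVec ψ) y|) ^ 2 ≤
      4 * (relEntropy w ψ - relEntropy w (M.mulVec ψ)) := by
  set ψ' := M.mulVec ψ with hψ'def
  have hψ' : ∀ y, 0 ≤ ψ' y := fun y =>
    Finset.sum_nonneg fun x _ => mul_nonneg (hM _ _) (hψ _)
  have hψ'1 : ∑ y, w y * ψ' y = 1 := (sum_weight_mul_mulVec hrow hrev ψ).trans hψ1
  have hc : ∀ p : X × X, 0 ≤ w p.1 * M p.1 p.2 := fun p => mul_nonneg (hw _).le (hM _ _)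
  have hdrop : ∑ p : X × X, w p.1 * M p.1 p.2 * (√(ψ p.2) - √(ψ' p.1)) ^ 2 ≤
      relEntropy w ψ - relEntropy w ψ' := by
    rw [Fintype.sum_prod_type]
    unfold relEntropy
    rw [← sum_weight_mul_mulVec hrow hrev, ← Finset.sum_sub_distrib]
    refine Finset.sum_le_sum fun y _ => ?_
    simp only [mul_assoc]
    rw [← Finset.mul_sum, ← mul_sub]
    exact mul_le_mul_of_nonneg_left (sum_mul_sq_sqrt_sub_le hM hrow hψ y) (hw y).le
  have hmass : ∑ p : X × X, w p.1 * M p.1 p.2 * (√(ψ p.2) + √(ψ' p.1)) ^ 2 ≤ 4 := by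
    calc ∑ p : X × X, w p.1 * M p.1 p.2 * (√(ψ p.2) + √(ψ' p.1)) ^ 2
        ≤ ∑ p : X × X, (2 * (w p.1 * (M p.1 p.2 * ψ p.2)) +
            2 * (w p.1 * ψ' p.1) * M p.1 p.2) := by
          refine Finset.sum_le_sum fun p _ => ?_
          have h : (√(ψ p.2) + √(ψ' p.1)) ^ 2 ≤ 2 * (ψ p.2 + ψ' p.1) := by
            nlinarith [Real.sq_sqrt (hψ p.2), Real.sq_sqrt (hψ' p.1),
              sq_nonneg (√(ψ p.2) - √(ψ' p.1))]
          nlinarith [mul_le_mul_of_nonneg_left h (hc p)]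
      _ = 4 := by
          rw [Fintype.sum_prod_type]
          simp only [Finset.sum_add_distrib, ← Finset.mul_sum, hrow, mul_one]
          rw [sum_weight_mul_mulVec hrow hrev, hψ1, hψ'1]
          norm_num
  have hcs := Finset.sum_mul_sq_le_sq_mul_sq (Finset.univ : Finset (X × X))
    (fun p => √(w p.1 * M p.1 p.2) * |√(ψ p.2) - √(ψ' p.1)|)
    (fun p => √(w p.1 * M p.1 p.2) * (√(ψ p.2) + √(ψ' p.1)))
  simp only [mul_pow, sq_abs, Real.sq_sqrt (hc _)] at hcs
  have heq : ∑ y, ∑ x, w y * M y x * |ψ x - ψ' y| =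
      ∑ p : X × X, √(w p.1 * M p.1 p.2) * |√(ψ p.2) - √(ψ' p.1)| *
        (√(w p.1 * M p.1 p.2) * (√(ψ p.2) + √(ψ' p.1))) := by
    rw [Fintype.sum_prod_type]
    refine Finset.sum_congr rfl fun y _ => Finset.sum_congr rfl fun x _ => ?_
    have h1 : ψ x - ψ' y = (√(ψ x) - √(ψ' y)) * (√(ψ x) + √(ψ' y)) := by
      nlinarith [Real.sq_sqrt (hψ x), Real.sq_sqrt (hψ' y)]
    rw [h1, abs_mul, abs_of_nonneg (add_nonneg (Real.sqrt_nonneg (ψ x)) (Real.sqrt_nonneg _))]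
    nth_rewrite 1 [← Real.mul_self_sqrt (hc (y, x))]
    ring
  rw [heq]
  refine hcs.trans ?_
  have h0 : 0 ≤ ∑ p : X × X, w p.1 * M p.1 p.2 * (√(ψ p.2) - √(ψ' p.1)) ^ 2 :=
    Finset.sum_nonneg fun p _ => mul_nonneg (hc p) (sq_nonneg _)
  nlinarith [mul_le_mul_of_nonneg_left hmass h0]

/-- For a lazy kernel the `L¹` Dirichlet form is controlled by the one-step `L¹` movement. -/
lemma sum_abs_sub_le_three_mul (hw : ∀ x, 0 < w x) (hM : ∀ x y, 0 ≤ M x y)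
    (hrow : ∀ x, ∑ y, M x y = 1) (hlazy : ∀ x, 1 / 2 ≤ M x x) (ψ' : X → ℝ) :
    ∑ y, ∑ x, w y * M y x * |ψ x - ψ y| ≤
      3 * ∑ y, ∑ x, w y * M y x * |ψ x - ψ' y| := by
  rw [Finset.mul_sum]
  refine Finset.sum_le_sum fun y _ => ?_
  have hc : ∀ x, 0 ≤ w y * M y x := fun x => mul_nonneg (hw y).le (hM y x)
  have hdiag : w y * M y y * |ψ y - ψ' y| ≤ ∑ x, w y * M y x * |ψ x - ψ' y| :=
    Finset.single_le_sum (f := fun x => w y * M y x * |ψ x - ψ' y|)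
      (fun x _ => mul_nonneg (hc x) (abs_nonneg _)) (Finset.mem_univ y)
  have htri : ∑ x, w y * M y x * |ψ x - ψ y| ≤
      ∑ x, w y * M y x * |ψ x - ψ' y| + w y * |ψ y - ψ' y| := by
    calc ∑ x, w y * M y x * |ψ x - ψ y|
        ≤ ∑ x, (w y * M y x * |ψ x - ψ' y| + w y * |ψ y - ψ' y| * M y x) := by
          refine Finset.sum_le_sum fun x _ => ?_
          have h := abs_sub_le (ψ x) (ψ' y) (ψ y)
          rw [abs_sub_comm (ψ' y)] at h
          nlinarith [mul_le_mul_of_nonneg_left h (hc x)]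
      _ = _ := by rw [Finset.sum_add_distrib, ← Finset.mul_sum, hrow, mul_one]
  have hlz := mul_le_mul_of_nonneg_left (hlazy y)
    (mul_nonneg (hw y).le (abs_nonneg (ψ y - ψ' y)))
  nlinarith

/-- Replacing a density by an `L¹`-close one changes the `L¹` Dirichlet form little. -/
lemma sum_abs_sub_le_add (hw : ∀ x, 0 < w x) (hM : ∀ x y, 0 ≤ M x y)
    (hrow : ∀ x, ∑ y, M x y = 1) (hrev : ∀ x y, w x * M x y = w y * M y x) (G : X → ℝ) :
    ∑ y, ∑ x, w y * M y x * |G x - G y| ≤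
      ∑ y, ∑ x, w y * M y x * |ψ x - ψ y| + 2 * ∑ x, w x * |ψ x - G x| := by
  have h1 : ∑ y, ∑ x, w y * M y x * |ψ x - G x| = ∑ x, w x * |ψ x - G x| := by
    rw [← sum_weight_mul_mulVec hrow hrev]
    simp only [Finset.mul_sum, mul_assoc]
  have h2 : ∑ y, ∑ x, w y * M y x * |ψ y - G y| = ∑ x, w x * |ψ x - G x| := by
    refine Finset.sum_congr rfl fun y _ => ?_
    rw [← Finset.sum_mul, ← Finset.mul_sum, hrow, mul_one]
  calc ∑ y, ∑ x, w y * M y x * |G x - G y|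
      ≤ ∑ y, ∑ x, (w y * M y x * |ψ x - ψ y| + w y * M y x * |ψ x - G x| +
          w y * M y x * |ψ y - G y|) := by
        refine Finset.sum_le_sum fun y _ => Finset.sum_le_sum fun x _ => ?_
        rw [← mul_add, ← mul_add]
        refine mul_le_mul_of_nonneg_left ?_ (mul_nonneg (hw y).le (hM y x))
        have := abs_sub_le (G x) (ψ x) (G y)
        have := abs_sub_le (ψ x) (ψ y) (G y)
        rw [abs_sub_comm (ψ x) (G x)]
        linarith
    _ = _ := by
        simp only [Finset.sum_add_distrib]
        rw [h1, h2]
        ring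

lemma one_sub_sum_weight_le_relEntropy (hw : ∀ x, 0 < w x) (hψ : ∀ x, 0 ≤ ψ x)
    (hψ1 : ∑ x, w x * ψ x = 1) : 1 - ∑ x, w x ≤ relEntropy w ψ := by
  unfold relEntropy
  rw [← hψ1, ← Finset.sum_sub_distrib]
  refine Finset.sum_le_sum fun x _ => ?_
  have h : ψ x - 1 ≤ ψ x * Real.log (ψ x) := by
    have := sq_sqrt_sub_sqrt_le_bregman (hψ x) one_pos
    simp only [Real.log_one] at this
    nlinarith [sq_nonneg (√(ψ x) - √1)]
  nlinarith [mul_le_mul_of_nonneg_left h (hw x).le]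

variable [DecidableEq X]

lemma rowDensity_succ (hw : ∀ x, 0 < w x) (hrev : ∀ x y, w x * M x y = w y * M y x)
    (z : X) (t : ℕ) :
    (fun y => (M ^ (t + 1)) z y / w y) = M.mulVec fun y => (M ^ t) z y / w y := by
  funext y
  simp only [pow_succ, Matrix.mul_apply, Matrix.mulVec, dotProduct, Finset.sum_div]
  refine Finset.sum_congr rfl fun x _ => ?_
  have hx := (hw x).ne'
  have hy := (hw y).ne'
  field_simp
  linear_combination (M ^ t) z x * hrev x y

lemma rowDensity_nonneg_and_sum (hw : ∀ x, 0 < w x) (hM : ∀ x y, 0 ≤ M x y)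
    (hrow : ∀ x, ∑ y, M x y = 1) (hrev : ∀ x y, w x * M x y = w y * M y x) (z : X) (t : ℕ) :
    (∀ y, 0 ≤ (M ^ t) z y / w y) ∧ ∑ y, w y * ((M ^ t) z y / w y) = 1 := by
  induction t with
  | zero =>
    refine ⟨fun y => div_nonneg ?_ (hw y).le, ?_⟩
    · rw [pow_zero, Matrix.one_apply]; split_ifs <;> norm_num
    · simp [mul_div_cancel₀ _ (hw _).ne', Matrix.one_apply]
  | succ t ih =>
    have h : ∀ y, (M ^ (t + 1)) z y / w y = ∑ x, M y x * ((M ^ t) z x / w x) := fun y =>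
      congrFun (rowDensity_succ (M := M) hw hrev z t) y
    simp only [h]
    exact ⟨fun y => Finset.sum_nonneg fun x _ => mul_nonneg (hM _ _) (ih.1 _),
      (sum_weight_mul_mulVec hrow hrev _).trans ih.2⟩

lemma relEntropy_rowDensity_zero (hw : ∀ x, 0 < w x) (z : X) :
    relEntropy w (fun y => (M ^ 0) z y / w y) = -Real.log (w z) := by
  unfold relEntropy
  rw [Finset.sum_eq_single z]
  · have := (hw z).ne'
    simp [this]
  · intro y _ hy
    simp [hy.symm]
  · simp

/-- Within `k` steps some row of a lazy reversible kernel has small `L¹` Dirichlet form. -/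
lemma exists_small_dirichlet (hw : ∀ x, 0 < w x) (hM : ∀ x y, 0 ≤ M x y)
    (hrow : ∀ x, ∑ y, M x y = 1) (hrev : ∀ x y, w x * M x y = w y * M y x)
    (hlazy : ∀ x, 1 / 2 ≤ M x x) (z : X) {k : ℕ} (hk : 0 < k) :
    ∃ t < k, k * (∑ y, ∑ x, w y * M y x * |(M ^ t) z x / w x - (M ^ t) z y / w y|) ^ 2 ≤
      36 * (-Real.log (w z) - 1 + ∑ x, w x) := by
  set D : ℕ → ℝ := fun t => relEntropy w fun y => (M ^ t) z y / w y with hD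
  have hsum : ∑ t ∈ Finset.range k, (D t - D (t + 1)) ≤
      ∑ _t ∈ Finset.range k, (-Real.log (w z) - 1 + ∑ x, w x) / k := by
    rw [Finset.sum_range_sub', Finset.sum_const, Finset.card_range, nsmul_eq_mul,
      mul_div_cancel₀ _ (by positivity)]
    obtain ⟨h1, h2⟩ := rowDensity_nonneg_and_sum (M := M) hw hM hrow hrev z k
    have := one_sub_sum_weight_le_relEntropy hw h1 h2
    have h0 : D 0 = _ := relEntropy_rowDensity_zero (M := M) hw z
    rw [h0]
    simp only [hD]
    linarith
  obtain ⟨t, ht, hle⟩ := Finset.exists_le_of_sum_le ⟨0, Finset.mem_range.2 hk⟩ hsum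
  refine ⟨t, Finset.mem_range.1 ht, ?_⟩
  obtain ⟨h1, h2⟩ := rowDensity_nonneg_and_sum (M := M) hw hM hrow hrev z t
  have hsq := sq_sum_abs_sub_mulVec_le hw hM hrow hrev h1 h2
  rw [← rowDensity_succ hw hrev] at hsq
  have h3 := sum_abs_sub_le_three_mul (ψ := fun y => (M ^ t) z y / w y) hw hM hrow hlazy
    (fun y => (M ^ (t + 1)) z y / w y)
  have hnn : 0 ≤ ∑ y, ∑ x, w y * M y x * |(M ^ t) z x / w x - (M ^ t) z y / w y| :=
    Finset.sum_nonneg fun y _ => Finset.sum_nonneg fun x _ =>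
      mul_nonneg (mul_nonneg (hw y).le (hM y x)) (abs_nonneg _)
  have hk' : (0 : ℝ) < k := by exact_mod_cast hk
  have h4 := pow_le_pow_left₀ hnn h3 2
  rw [mul_pow] at h4
  rw [le_div_iff₀ hk'] at hle
  have h5 : (∑ y, ∑ x, w y * M y x * |(M ^ t) z x / w x - (M ^ t) z y / w y|) ^ 2 ≤
      36 * (D t - D (t + 1)) := by
    simp only [hD]
    linarith
  nlinarith [mul_le_mul_of_nonneg_left h5 hk'.le]

end ReversibleKernel

section TraceFamily

variable {Q : ℕ} {R : Type} [Fintype R] [DecidableEq R] {piR : R → ℝ}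
  {K : Equiv.Perm (Fin Q) → R → R → ℝ} {θ : ℝ}

lemma liftK_nonneg (hK : ∀ g u v, 0 ≤ K g u v) (p q : R × Fin Q) : 0 ≤ liftK K p q := by
  simp only [liftK, Matrix.of_apply]
  refine Finset.sum_nonneg fun g _ => ?_
  split_ifs
  exacts [hK _ _ _, le_rfl]

/-- One step of the label lift: average over the trace step and the transported label. -/
lemma sum_liftK_mul (p : R × Fin Q) (f : R × Fin Q → ℝ) :
    ∑ q, liftK K p q * f q = ∑ v, ∑ g : Equiv.Perm (Fin Q), K g p.1 v * f (v, g p.2) := by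
  rw [Fintype.sum_prod_type]
  refine Finset.sum_congr rfl fun v _ => ?_
  simp only [liftK, Matrix.of_apply, Finset.sum_mul]
  rw [Finset.sum_comm]
  refine Finset.sum_congr rfl fun g _ => ?_
  simp [ite_mul]

lemma liftK_reversible (hrev : ∀ g u v, piR u * K g u v = piR v * K g⁻¹ v u)
    (p q : R × Fin Q) : piR p.1 * liftK K p q = piR q.1 * liftK K q p := by
  simp only [liftK, Matrix.of_apply, Finset.mul_sum]
  refine Fintype.sum_equiv (Equiv.inv _) _ _ fun g => ?_
  have h : g p.2 = q.2 ↔ g⁻¹ q.2 = p.2 := by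
    rw [Equiv.Perm.inv_eq_iff_eq, eq_comm]
  simp only [Equiv.inv_apply, h]
  split_ifs
  · exact hrev g _ _
  · simp

lemma liftK_lazy (hK : ∀ g u v, 0 ≤ K g u v) (hlazy : ∀ u, (1 / 2 : ℝ) ≤ K 1 u u)
    (p : R × Fin Q) : 1 / 2 ≤ liftK K p p := by
  refine (hlazy p.1).trans ?_
  simp only [liftK, Matrix.of_apply]
  have := Finset.single_le_sum (f := fun g : Equiv.Perm (Fin Q) =>
    if g p.2 = p.2 then K g p.1 p.1 else 0)
    (fun g _ => by split_ifs; exacts [hK _ _ _, le_rfl]) (Finset.mem_univ 1)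
  simpa using this

lemma betaTr_singleton_le_one (hpi : ∀ u, 0 < piR u) (hK : ∀ g u v, 0 ≤ K g u v)
    (hrow : ∀ u, ∑ v : R, ∑ g : Equiv.Perm (Fin Q), K g u v = 1) (u : R) (ℓ : R → Fin Q) :
    betaTr piR K {u} ℓ ≤ 1 := by
  unfold betaTr
  rw [Finset.sum_singleton, Finset.sum_singleton, ← mul_assoc, inv_mul_cancel₀ (hpi u).ne',
    one_mul, ← hrow u, ← Finset.sum_compl_add_sum ({u} : Finset R)]
  gcongr with v _ g
  split_ifs
  exacts [le_rfl, hK _ _ _]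

lemma betaTr_mul_sum (hpi : ∀ u, 0 < piR u) {S : Finset R} (hS : S.Nonempty)
    (ℓ : R → Fin Q) :
    betaTr piR K S ℓ * ∑ u ∈ S, piR u = ∑ u ∈ S, piR u * ∑ v, ∑ g : Equiv.Perm (Fin Q),
      if v ∈ S ∧ ℓ v = g (ℓ u) then 0 else K g u v := by
  have h0 : ∑ u ∈ S, piR u ≠ 0 := (Finset.sum_pos (fun u _ => hpi u) hS).ne'
  unfold betaTr
  rw [mul_right_comm, inv_mul_cancel₀ h0, one_mul]
  refine Finset.sum_congr rfl fun u _ => ?_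
  congr 1
  rw [← Finset.sum_compl_add_sum S]
  congr 1
  · refine Finset.sum_congr rfl fun v hv => Finset.sum_congr rfl fun g _ => ?_
    rw [if_neg fun h => Finset.mem_compl.1 hv h.1]
  · refine Finset.sum_congr rfl fun v hv => Finset.sum_congr rfl fun g _ => ?_
    by_cases h : ℓ v = g (ℓ u) <;> simp [h, hv]

/-- Coarea inequality: for functions supported on the graph of a labeling, the `L¹` boundary
dominates the mass. -/
lemma le_sum_posPart_of_le_betaTr (hpi : ∀ u, 0 < piR u)
    (ℓ : R → Fin Q)
    (hβ : ∀ S : Finset R, S.Nonempty → θ ≤ betaTr piR K S ℓ)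
    (g : R → ℝ) (hg : ∀ u, 0 ≤ g u) (hK : ∀ σ u v, 0 ≤ K σ u v) :
    θ * ∑ u, piR u * g u ≤ ∑ u, piR u * ∑ v, ∑ σ : Equiv.Perm (Fin Q),
      K σ u v * max (g u - if ℓ v = σ (ℓ u) then g v else 0) 0 := by
  induction hn : (Finset.univ.filter fun u => 0 < g u).card using Nat.strong_induction_on
    generalizing g with
  | _ n ih =>
  set S := Finset.univ.filter fun u => 0 < g u with hS
  have hmem : ∀ u, u ∈ S ↔ 0 < g u := fun u => by simp [hS]
  have hzero : ∀ u, u ∉ S → g u = 0 := fun u hu =>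
    le_antisymm (not_lt.1 fun h => hu ((hmem u).2 h)) (hg u)
  rcases S.eq_empty_or_nonempty with hE | hne
  · have hg0 : ∀ u, g u = 0 := fun u => hzero u (by simp [hE])
    simp [hg0]
  obtain ⟨u₀, hu₀, hmin⟩ := S.exists_min_image g hne
  set m := g u₀ with hm
  have hm0 : 0 < m := (hmem u₀).1 hu₀
  let g' : R → ℝ := fun u => if u ∈ S then g u - m else 0
  have hg'S : ∀ u ∈ S, g' u = g u - m := fun u hu => if_pos hu
  have hg'n : ∀ u, u ∉ S → g' u = 0 := fun u hu => if_neg hu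
  have hg' : ∀ u, 0 ≤ g' u := fun u => by
    by_cases hu : u ∈ S
    · rw [hg'S u hu]; linarith [hmin u hu]
    · rw [hg'n u hu]
  have hcard : (Finset.univ.filter fun u => 0 < g' u).card < n := by
    rw [← hn]
    refine Finset.card_lt_card ⟨fun u hu => ?_, fun hsub => ?_⟩
    · by_contra h
      simp [hg'n u h] at hu
    · have := hsub hu₀
      simp [hg'S u₀ hu₀, ← hm] at this
  have hind := ih _ hcard g' hg' rfl
  have hmass : ∑ u, piR u * g u = ∑ u, piR u * g' u + m * ∑ u ∈ S, piR u := by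
    rw [← Finset.sum_add_sum_compl S, ← Finset.sum_add_sum_compl S (fun u => piR u * g' u),
      Finset.sum_congr rfl (fun u hu => by rw [hg'S u hu] :
        ∀ u ∈ S, piR u * g' u = piR u * (g u - m)),
      Finset.sum_eq_zero (fun u hu => by rw [hg'n u (Finset.mem_compl.1 hu), mul_zero] :
        ∀ u ∈ Sᶜ, piR u * g' u = 0),
      Finset.sum_eq_zero (fun u hu => by rw [hzero u (Finset.mem_compl.1 hu), mul_zero] :
        ∀ u ∈ Sᶜ, piR u * g u = 0), Finset.mul_sum]
    simp only [mul_sub, Finset.sum_sub_distrib, mul_comm m]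
    ring
  have hcut := mul_le_mul_of_nonneg_right (hβ S hne)
    (Finset.sum_nonneg fun u (_ : u ∈ S) => (hpi u).le)
  rw [betaTr_mul_sum hpi hne] at hcut
  have hform : ∑ u, piR u * ∑ v, ∑ σ : Equiv.Perm (Fin Q),
        K σ u v * max (g' u - if ℓ v = σ (ℓ u) then g' v else 0) 0 +
      m * ∑ u ∈ S, piR u * ∑ v, ∑ σ : Equiv.Perm (Fin Q),
        (if v ∈ S ∧ ℓ v = σ (ℓ u) then 0 else K σ u v) ≤
      ∑ u, piR u * ∑ v, ∑ σ : Equiv.Perm (Fin Q),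
        K σ u v * max (g u - if ℓ v = σ (ℓ u) then g v else 0) 0 := by
    rw [Finset.mul_sum, ← Finset.sum_add_sum_compl S, add_right_comm,
      ← Finset.sum_add_distrib, ← Finset.sum_add_sum_compl S (fun u => piR u * ∑ v,
        ∑ σ : Equiv.Perm (Fin Q), K σ u v * max (g u - if ℓ v = σ (ℓ u) then g v else 0) 0)]
    refine add_le_add (Finset.sum_le_sum fun u hu => ?_) (Finset.sum_le_sum fun u hu => ?_)
    · rw [mul_left_comm, ← mul_add]
      refine mul_le_mul_of_nonneg_left (le_of_eq ?_) (hpi u).le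
      rw [Finset.mul_sum, ← Finset.sum_add_distrib]
      refine Finset.sum_congr rfl fun v _ => ?_
      rw [Finset.mul_sum, ← Finset.sum_add_distrib]
      refine Finset.sum_congr rfl fun σ _ => ?_
      have hgu := hmin u hu
      by_cases hv : v ∈ S <;> by_cases hl : ℓ v = σ (ℓ u)
      · simp [hv, hl, hg'S u hu, hg'S v hv]
      · simp only [hl, and_false, if_false, sub_zero, hg'S u hu]
        rw [max_eq_left (by linarith), max_eq_left (hg u)]
        ring
      all_goals
        simp only [hl, hv, and_false, false_and, if_true, if_false, sub_zero, hg'S u hu,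
          hg'n v hv, hzero v hv]
        rw [max_eq_left (by linarith), max_eq_left (hg u)]
        ring
    · have hu' := Finset.mem_compl.1 hu
      refine mul_le_mul_of_nonneg_left (Finset.sum_le_sum fun v _ =>
        Finset.sum_le_sum fun σ _ => ?_) (hpi u).le
      refine mul_le_mul_of_nonneg_left ?_ (hK σ u v)
      rw [hg'n u hu', max_eq_right]
      · exact le_max_right _ _
      · split_ifs <;> linarith [hg' v]
  rw [hmass]
  nlinarith [mul_le_mul_of_nonneg_left hcut hm0.le]

/-- A start of not too small mass becomes ambiguous within `k` steps from every label. -/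
lemma exists_le_AmbT (hpi : ∀ u, 0 < piR u) (hpi1 : ∑ u, piR u = 1)
    (hK : ∀ g u v, 0 ≤ K g u v)
    (hrow : ∀ u, ∑ v : R, ∑ g : Equiv.Perm (Fin Q), K g u v = 1)
    (hrev : ∀ g u v, piR u * K g u v = piR v * K g⁻¹ v u)
    (hlazy : ∀ u, (1 / 2 : ℝ) ≤ K 1 u u) (hθ : 0 < θ)
    (hβ : ∀ S : Finset R, S.Nonempty → ∀ ℓ : R → Fin Q, θ ≤ betaTr piR K S ℓ)
    {k : ℕ} {L : ℝ} (hL : 1 ≤ L) (hk : 144 * Q / θ ^ 2 * L ≤ k)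
    (s : R) (hs : -Real.log (piR s) ≤ L) (a : Fin Q) :
    ∃ t ≤ k, 1 / 8 * θ ≤ AmbT K s a t := by
  have hQ : (1 : ℝ) ≤ Q := by exact_mod_cast Fin.pos a
  have hQne : Nonempty (Fin Q) := ⟨a⟩
  have hθ1 : θ ≤ 1 := (hβ {s} (Finset.singleton_nonempty s) fun _ => a).trans
    (betaTr_singleton_le_one hpi hK hrow s _)
  have hkpos : (0 : ℝ) < k := lt_of_lt_of_le (by positivity) hk
  have hw : ∀ p : R × Fin Q, 0 < piR p.1 := fun p => hpi _
  have hM := liftK_nonneg hK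
  have hMrow : ∀ p, ∑ q, liftK K p q = 1 := fun p => by
    simpa [hrow] using sum_liftK_mul (K := K) p fun _ => 1
  have hMrev := liftK_reversible hrev
  have hMlazy := liftK_lazy hK hlazy
  obtain ⟨t, htk, ht⟩ := exists_small_dirichlet (w := fun p : R × Fin Q => piR p.1) hw hM hMrow
    hMrev hMlazy (s, a) (Nat.cast_pos.1 hkpos)
  refine ⟨t, htk.le, ?_⟩
  set ψ : R × Fin Q → ℝ := fun p => (liftK K ^ t) (s, a) p / piR p.1 with hψdef
  obtain ⟨hψ0, hψ1⟩ := rowDensity_nonneg_and_sum (w := fun p : R × Fin Q => piR p.1) hw hM hMrow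
    hMrev (s, a) t
  change ∀ y, 0 ≤ ψ y at hψ0
  change ∑ y : R × Fin Q, piR y.1 * ψ y = 1 at hψ1
  set E := ∑ y : R × Fin Q, ∑ x, piR y.1 * liftK K y x * |ψ x - ψ y| with hE
  have hwsum : ∑ p : R × Fin Q, piR p.1 = Q := by
    rw [Fintype.sum_prod_type]
    simp [← Finset.mul_sum, hpi1]
  have hEle : E ≤ θ / 2 := by
    have h1 : (k : ℝ) * E ^ 2 ≤ 36 * (-Real.log (piR s) - 1 + Q) := by
      rw [← hwsum]; exact ht
    have h2 : 144 * Q * L ≤ k * θ ^ 2 := by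
      rw [div_mul_eq_mul_div, div_le_iff₀ (by positivity)] at hk
      exact hk
    have h3 : (k : ℝ) * E ^ 2 ≤ k * (θ / 2) ^ 2 := by
      nlinarith [mul_nonneg (sub_nonneg.2 hQ) (sub_nonneg.2 hL)]
    exact le_of_sq_le_sq (le_of_mul_le_mul_left h3 hkpos) (by positivity)
  have hmax : ∀ v, ∃ b, (liftK K ^ t) (s, a) (v, b) = ⨆ b, (liftK K ^ t) (s, a) (v, b) :=
    fun v => exists_eq_ciSup_of_finite
  choose ℓ hℓ using hmax
  let G : R × Fin Q → ℝ := fun p => if p.2 = ℓ p.1 then ψ p else 0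
  have hp : ∀ p : R × Fin Q, (liftK K ^ t) (s, a) p = piR p.1 * ψ p := fun p => by
    rw [hψdef, mul_div_cancel₀ _ (hw p).ne']
  simp only [hp] at hℓ
  have hAmbG : AmbT K s a t = ∑ p : R × Fin Q, piR p.1 * |ψ p - G p| := by
    rw [AmbT, Fintype.sum_prod_type]
    refine Finset.sum_congr rfl fun v _ => ?_
    have : ∀ b, piR v * |ψ (v, b) - G (v, b)| =
        piR v * ψ (v, b) - if b = ℓ v then piR v * ψ (v, b) else 0 := fun b => by
      by_cases h : b = ℓ v <;> simp [G, h, abs_of_nonneg (hψ0 _)]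
    simp only [this, Finset.sum_sub_distrib, hp, ← hℓ]
    simp
  have hAmb1 : ∑ v, piR v * ψ (v, ℓ v) = 1 - AmbT K s a t := by
    rw [AmbT, Finset.sum_sub_distrib, ← Fintype.sum_prod_type
      (fun p : R × Fin Q => (liftK K ^ t) (s, a) p)]
    simp only [hp, hψ1, ← hℓ]
    ring
  have hco := le_sum_posPart_of_le_betaTr (K := K) (θ := θ) hpi ℓ (fun S hS => hβ S hS ℓ)
    (fun v => ψ (v, ℓ v)) (fun v => hψ0 _) hK
  have hGform : ∑ u, piR u * ∑ v, ∑ σ : Equiv.Perm (Fin Q),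
      K σ u v * max (ψ (u, ℓ u) - if ℓ v = σ (ℓ u) then ψ (v, ℓ v) else 0) 0 ≤
      ∑ y : R × Fin Q, ∑ x, piR y.1 * liftK K y x * |G x - G y| := by
    rw [Fintype.sum_prod_type]
    refine Finset.sum_le_sum fun u _ => ?_
    have hsingle := Finset.single_le_sum (f := fun b : Fin Q =>
      ∑ x, piR u * liftK K (u, b) x * |G x - G (u, b)|)
      (fun b _ => Finset.sum_nonneg fun x _ =>
        mul_nonneg (mul_nonneg (hpi u).le (hM _ _)) (abs_nonneg _)) (Finset.mem_univ (ℓ u))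
    refine le_trans ?_ hsingle
    simp only [mul_assoc]
    rw [← Finset.mul_sum, sum_liftK_mul]
    refine mul_le_mul_of_nonneg_left (Finset.sum_le_sum fun v _ => Finset.sum_le_sum fun σ _ =>
      mul_le_mul_of_nonneg_left ?_ (hK _ _ _)) (hpi u).le
    have hGv : G (v, σ (ℓ u)) = if ℓ v = σ (ℓ u) then ψ (v, ℓ v) else 0 := by
      by_cases h : ℓ v = σ (ℓ u)
      · simp [G, h]
      · simp [G, h, Ne.symm h]
    have hGu : G (u, ℓ u) = ψ (u, ℓ u) := by simp [G]
    rw [hGu, ← hGv, abs_sub_comm]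
    exact max_le (le_abs_self _) (abs_nonneg _)
  have hGle := sum_abs_sub_le_add (ψ := ψ) hw hM hMrow hMrev G
  rw [← hAmbG] at hGle
  rw [hAmb1] at hco
  by_contra! hlt
  nlinarith [mul_lt_mul_of_pos_left hlt hθ]

end TraceFamily

/-- Trace steps that often fail force ambiguity at some trace time: if `β_R(S,ℓ) ≥ θ` for every
nonempty `S` and every `ℓ`, then for every `k ≥ C_Q θ⁻² log(8|R|)`, the starts `s` such that
every label `a` has a time `t_a ≤ k` with `Amb_{t_a}(s,a) ≥ c_Q θ` have `π_R`-mass `≥ 3/4`. -/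
theorem stmt6 (Q : ℕ) (hQ : 2 ≤ Q) :
    ∃ C > (0 : ℝ), ∃ c > (0 : ℝ),
      ∀ (R : Type) [Fintype R] [DecidableEq R] [Nonempty R],
      ∀ (piR : R → ℝ) (K : Equiv.Perm (Fin Q) → R → R → ℝ) (θ : ℝ),
        (∀ u, 0 < piR u) → (∑ u, piR u = 1) →
        (∀ g u v, 0 ≤ K g u v) →
        (∀ u, ∑ v : R, ∑ g : Equiv.Perm (Fin Q), K g u v = 1) →
        (∀ g u v, piR u * K g u v = piR v * K g⁻¹ v u) →
        (∀ u, (1 / 2 : ℝ) ≤ K 1 u u) →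
        0 < θ →
        (∀ S : Finset R, S.Nonempty → ∀ ℓ : R → Fin Q, θ ≤ betaTr piR K S ℓ) →
        ∀ k : ℕ, C / θ ^ 2 * Real.log (8 * (Fintype.card R : ℝ)) ≤ (k : ℝ) →
          (3 / 4 : ℝ) ≤
            ∑ s ∈ Finset.univ.filter
              (fun s : R => ∀ a : Fin Q, ∃ t ≤ k, c * θ ≤ AmbT K s a t), piR s := by
  refine ⟨144 * Q, by positivity, 1 / 8, by norm_num, ?_⟩
  intro R _ _ _ piR K θ hpi hpi1 hK hrow hrev hlazy hθ hβ k hk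
  have hn : (1 : ℝ) ≤ Fintype.card R := by exact_mod_cast Fintype.card_pos
  set N : ℝ := 8 * (Fintype.card R : ℝ) with hN
  have hNpos : 0 < N := by positivity
  have hL : 1 ≤ Real.log N := by
    rw [Real.le_log_iff_exp_le hNpos]
    linarith [Real.exp_one_lt_d9]
  have hsub : (Finset.univ.filter fun s => 1 / N ≤ piR s) ⊆ Finset.univ.filter
      (fun s : R => ∀ a : Fin Q, ∃ t ≤ k, 1 / 8 * θ ≤ AmbT K s a t) := by
    intro s hs
    simp only [Finset.mem_filter, Finset.mem_univ, true_and] at hs ⊢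
    refine exists_le_AmbT hpi hpi1 hK hrow hrev hlazy hθ hβ hL hk s ?_
    have := Real.log_le_log (by positivity) hs
    rw [one_div, Real.log_inv] at this
    linarith
  refine le_trans ?_ (Finset.sum_le_sum_of_subset_of_nonneg hsub fun s _ _ => (hpi s).le)
  have hsplit := Finset.sum_filter_add_sum_filter_not Finset.univ (fun s => 1 / N ≤ piR s) piR
  have hsmall : ∑ s ∈ Finset.univ.filter (fun s => ¬ 1 / N ≤ piR s), piR s ≤ 1 / 8 := by
    calc ∑ s ∈ Finset.univ.filter (fun s => ¬ 1 / N ≤ piR s), piR s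
        ≤ ∑ _s ∈ Finset.univ.filter (fun s => ¬ 1 / N ≤ piR s), 1 / N :=
          Finset.sum_le_sum fun s hs => (not_le.1 (Finset.mem_filter.1 hs).2).le
      _ ≤ ∑ _s : R, 1 / N :=
          Finset.sum_le_sum_of_subset_of_nonneg (Finset.filter_subset _ _)
            fun _ _ _ => by positivity
      _ = 1 / 8 := by
          rw [Finset.sum_const, Finset.card_univ, nsmul_eq_mul, hN]
          field_simp
  linarith
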